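/- arXiv:2510.26106 — 9 statements merged into one kernel-verified Lean document; each statement's English description precedes it below -/
import Mathlib

section
/- In the linear factor model, the following implications hold for the fixed λ ∈ Δ_{|𝒯₀|−1} and w ∈ Δ_{K−1}: if (iii) E[Λ | G = 0] = Σ_{j=1}^K w_j E[Λ | G = j] (equality of vectors in ℝ^M), then (ii) GMC holds at (λ̃, w) for every λ̃ ∈ Δ_{|𝒯₀|−1}; and (ii) implies (i) GMC holds at (λ, w). -/
open MeasureTheory Classical

noncomputable section

/-- Conditional expectation `E[X | A]`: the expectation of `X` under `P(· | A)`. -/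
def cExp {Ω : Type*} [MeasurableSpace Ω] (P : Measure Ω)
    (X : Ω → ℝ) (A : Set Ω) : ℝ :=
  (∫ ω in A, X ω ∂P) / (P A).toReal

/-- The matching error `e_t(λ,w)` from matching the `λ`-differenced mean untreated
outcome of group `0` with the `w`-weighted average over the donor groups `1,…,K`,
with `p` pre-treatment periods. -/
def eErr {Ω : Type*} [MeasurableSpace Ω] (P : Measure Ω) (G : Ω → ℕ)
    (Y0 : ℕ → Ω → ℝ) (K p : ℕ) (lam w : ℕ → ℝ) (t : ℕ) : ℝ :=
  cExp P (fun ω => Y0 t ω - ∑ s ∈ Finset.Icc 1 p, lam s * Y0 s ω) {ω | G ω = 0}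
    - ∑ j ∈ Finset.Icc 1 K, w j *
        cExp P (fun ω => Y0 t ω - ∑ s ∈ Finset.Icc 1 p, lam s * Y0 s ω) {ω | G ω = j}

/-- In the linear factor model, (iii) equality of matched factor
loadings implies (ii) GMC at `(λ̃, w)` for every `λ̃` in the simplex, which in turn
implies (i) GMC at `(λ, w)`. -/
theorem factor_model_gmc_implications
    {Ω : Type*} [MeasurableSpace Ω] (P : Measure Ω) [IsProbabilityMeasure P]
    (M K T Tstar : ℕ) (hM : 1 ≤ M) (hK : 1 ≤ K) (hT : 2 ≤ T)
    (hTstar : 1 < Tstar) (hTsT : Tstar ≤ T)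
    (G : Ω → ℕ) (hGmeas : Measurable G) (hGrange : ∀ ω, G ω ≤ K)
    (hPG : ∀ j ≤ K, 0 < P {ω | G ω = j})
    (Lam : Ω → Fin M → ℝ) (hLamInt : ∀ k, Integrable (fun ω => Lam ω k) P)
    (F : ℕ → Fin M → ℝ)
    (eps : ℕ → Ω → ℝ) (hepsInt : ∀ t ∈ Finset.Icc 1 T, Integrable (eps t) P)
    (hepsMean : ∀ t ∈ Finset.Icc 1 T, ∀ j ≤ K, ∫ ω in {ω | G ω = j}, eps t ω ∂P = 0)
    (Y0 : ℕ → Ω → ℝ)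
    (hY0 : ∀ t ∈ Finset.Icc 1 T, ∀ ω, Y0 t ω = (∑ k, Lam ω k * F t k) + eps t ω)
    (lam : ℕ → ℝ) (hlam0 : ∀ s ∈ Finset.Icc 1 (Tstar - 1), 0 ≤ lam s)
    (hlam1 : ∑ s ∈ Finset.Icc 1 (Tstar - 1), lam s = 1)
    (w : ℕ → ℝ) (hw0 : ∀ j ∈ Finset.Icc 1 K, 0 ≤ w j)
    (hw1 : ∑ j ∈ Finset.Icc 1 K, w j = 1) :
    -- (iii) → (ii)
    (((∀ k : Fin M, cExp P (fun ω => Lam ω k) {ω | G ω = 0}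
        = ∑ j ∈ Finset.Icc 1 K, w j * cExp P (fun ω => Lam ω k) {ω | G ω = j}) →
      (∀ lam' : ℕ → ℝ, (∀ s ∈ Finset.Icc 1 (Tstar - 1), 0 ≤ lam' s) →
        (∑ s ∈ Finset.Icc 1 (Tstar - 1), lam' s = 1) →
        ∀ t ∈ Finset.Icc Tstar T, eErr P G Y0 K (Tstar - 1) lam' w t = 0)))
    ∧
    -- (ii) → (i)
    (((∀ lam' : ℕ → ℝ, (∀ s ∈ Finset.Icc 1 (Tstar - 1), 0 ≤ lam' s) →
        (∑ s ∈ Finset.Icc 1 (Tstar - 1), lam' s = 1) →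
        ∀ t ∈ Finset.Icc Tstar T, eErr P G Y0 K (Tstar - 1) lam' w t = 0) →
      (∀ t ∈ Finset.Icc Tstar T, eErr P G Y0 K (Tstar - 1) lam w t = 0))) := by
  refine ⟨?_, fun h => h lam hlam0 hlam1⟩
  intro hL lam' _ _ t ht
  have htT : t ∈ Finset.Icc 1 T := by
    simp only [Finset.mem_Icc] at ht ⊢
    omega
  have hsT : ∀ s ∈ Finset.Icc 1 (Tstar - 1), s ∈ Finset.Icc 1 T := by
    intro s hs
    simp only [Finset.mem_Icc] at hs ⊢
    omega
  have hSumInt : ∀ t, Integrable (fun ω => ∑ k, Lam ω k * F t k) P := fun t =>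
    integrable_finsetSum _ (fun k _ => (hLamInt k).mul_const _)
  have hYfun : ∀ t ∈ Finset.Icc 1 T,
      Y0 t = fun ω => (∑ k, Lam ω k * F t k) + eps t ω := fun t ht => funext (hY0 t ht)
  have hYInt : ∀ t ∈ Finset.Icc 1 T, Integrable (Y0 t) P := by
    intro t ht
    rw [hYfun t ht]
    exact (hSumInt t).add (hepsInt t ht)
  have hYmean : ∀ t ∈ Finset.Icc 1 T, ∀ j ≤ K, ∫ ω in {ω | G ω = j}, Y0 t ω ∂P
      = ∑ k, (∫ ω in {ω | G ω = j}, Lam ω k ∂P) * F t k := by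
    intro t ht j hj
    rw [hYfun t ht, integral_add (hSumInt t).integrableOn (hepsInt t ht).integrableOn,
      hepsMean t ht j hj, add_zero,
      integral_finsetSum _ (fun k _ => ((hLamInt k).mul_const _).integrableOn)]
    exact Finset.sum_congr rfl (fun k _ => integral_mul_const _ _)
  have key : ∀ j ≤ K,
      cExp P (fun ω => Y0 t ω - ∑ s ∈ Finset.Icc 1 (Tstar - 1), lam' s * Y0 s ω) {ω | G ω = j}
      = ∑ k, (F t k - ∑ s ∈ Finset.Icc 1 (Tstar - 1), lam' s * F s k) *
          cExp P (fun ω => Lam ω k) {ω | G ω = j} := by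
    intro j hj
    unfold cExp
    have h1 : ∀ s ∈ Finset.Icc 1 (Tstar - 1), Integrable (fun ω => lam' s * Y0 s ω)
        (P.restrict {ω | G ω = j}) := fun s hs =>
      ((hYInt s (hsT s hs)).const_mul _).integrableOn
    have h2 : ∫ ω in {ω | G ω = j}, ∑ s ∈ Finset.Icc 1 (Tstar - 1), lam' s * Y0 s ω ∂P
        = ∑ k, (∑ s ∈ Finset.Icc 1 (Tstar - 1), lam' s * F s k) *
          ∫ ω in {ω | G ω = j}, Lam ω k ∂P := by
      rw [integral_finsetSum _ h1]
      simp_rw [Finset.sum_mul]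
      rw [Finset.sum_comm]
      refine Finset.sum_congr rfl (fun s hs => ?_)
      rw [integral_const_mul, hYmean s (hsT s hs) j hj, Finset.mul_sum]
      exact Finset.sum_congr rfl (fun k _ => by ring)
    rw [integral_sub (hYInt t htT).integrableOn (integrable_finsetSum _ h1), h2,
      hYmean t htT j hj, ← Finset.sum_sub_distrib, Finset.sum_div]
    exact Finset.sum_congr rfl (fun k _ => by ring)
  unfold eErr
  rw [key 0 (Nat.zero_le _), sub_eq_zero]
  simp_rw [hL, Finset.mul_sum]
  rw [Finset.sum_comm]
  refine Finset.sum_congr rfl (fun j hj => ?_)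
  rw [key j (Finset.mem_Icc.mp hj).2, Finset.mul_sum]
  exact Finset.sum_congr rfl (fun k _ => by ring)

end
end

section
/- In the linear factor model, suppose the vectors {F_t(λ) : t ∈ 𝒯₁} span ℝ^M (full row rank of the matrix [F_{T*}(λ),…,F_T(λ)]). Then the following three statements are equivalent: (i) GMC holds at (λ, w); (ii) GMC holds at (λ̃, w) for every λ̃ ∈ Δ_{|𝒯₀|−1}; (iii) E[Λ | G = 0] = Σ_{j=1}^K w_j E[Λ | G = j]. -/
open MeasureTheory Classical

noncomputable section

/-- In the linear factor model, if the `λ`-differenced post-treatment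
factors `{F_t(λ) : t ∈ 𝒯₁}` span `ℝ^M`, then (i) GMC at `(λ,w)`, (ii) GMC at `(λ̃,w)`
for every `λ̃` in the simplex, and (iii) equality of matched factor loadings, are all
equivalent. -/
theorem factor_model_gmc_equivalence
    {Ω : Type*} [MeasurableSpace Ω] (P : Measure Ω) [IsProbabilityMeasure P]
    (M K T Tstar : ℕ) (hM : 1 ≤ M) (hK : 1 ≤ K) (hT : 2 ≤ T)
    (hTstar : 1 < Tstar) (hTsT : Tstar ≤ T)
    (G : Ω → ℕ) (hGmeas : Measurable G) (hGrange : ∀ ω, G ω ≤ K)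
    (hPG : ∀ j ≤ K, 0 < P {ω | G ω = j})
    (Lam : Ω → Fin M → ℝ) (hLamInt : ∀ k, Integrable (fun ω => Lam ω k) P)
    (F : ℕ → Fin M → ℝ)
    (eps : ℕ → Ω → ℝ) (hepsInt : ∀ t ∈ Finset.Icc 1 T, Integrable (eps t) P)
    (hepsMean : ∀ t ∈ Finset.Icc 1 T, ∀ j ≤ K, ∫ ω in {ω | G ω = j}, eps t ω ∂P = 0)
    (Y0 : ℕ → Ω → ℝ)
    (hY0 : ∀ t ∈ Finset.Icc 1 T, ∀ ω, Y0 t ω = (∑ k, Lam ω k * F t k) + eps t ω)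
    (lam : ℕ → ℝ) (hlam0 : ∀ s ∈ Finset.Icc 1 (Tstar - 1), 0 ≤ lam s)
    (hlam1 : ∑ s ∈ Finset.Icc 1 (Tstar - 1), lam s = 1)
    (w : ℕ → ℝ) (hw0 : ∀ j ∈ Finset.Icc 1 K, 0 ≤ w j)
    (hw1 : ∑ j ∈ Finset.Icc 1 K, w j = 1)
    -- full row rank: the differenced post-treatment factors span ℝ^M
    (hSpan : Submodule.span ℝ
        ((fun t => fun k => F t k - ∑ s ∈ Finset.Icc 1 (Tstar - 1), lam s * F s k) ''
          (Finset.Icc Tstar T : Finset ℕ)) = (⊤ : Submodule ℝ (Fin M → ℝ))) :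
    -- (i) ↔ (ii)
    ((∀ t ∈ Finset.Icc Tstar T, eErr P G Y0 K (Tstar - 1) lam w t = 0)
      ↔ (∀ lam' : ℕ → ℝ, (∀ s ∈ Finset.Icc 1 (Tstar - 1), 0 ≤ lam' s) →
          (∑ s ∈ Finset.Icc 1 (Tstar - 1), lam' s = 1) →
          ∀ t ∈ Finset.Icc Tstar T, eErr P G Y0 K (Tstar - 1) lam' w t = 0))
    ∧
    -- (ii) ↔ (iii)
    ((∀ lam' : ℕ → ℝ, (∀ s ∈ Finset.Icc 1 (Tstar - 1), 0 ≤ lam' s) →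
        (∑ s ∈ Finset.Icc 1 (Tstar - 1), lam' s = 1) →
        ∀ t ∈ Finset.Icc Tstar T, eErr P G Y0 K (Tstar - 1) lam' w t = 0)
      ↔ (∀ k : Fin M, cExp P (fun ω => Lam ω k) {ω | G ω = 0}
          = ∑ j ∈ Finset.Icc 1 K, w j * cExp P (fun ω => Lam ω k) {ω | G ω = j})) := by
  have hIccT : ∀ s ∈ Finset.Icc 1 (Tstar - 1), s ∈ Finset.Icc 1 T := by
    intro s hs
    simp only [Finset.mem_Icc] at hs ⊢
    omega
  have hpost : ∀ t ∈ Finset.Icc Tstar T, t ∈ Finset.Icc 1 T := by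
    intro s hs
    simp only [Finset.mem_Icc] at hs ⊢
    omega
  -- integrability of the untreated outcomes
  have hYint : ∀ t ∈ Finset.Icc 1 T, Integrable (Y0 t) P := by
    intro t ht
    have h : Y0 t = fun ω => (∑ k, Lam ω k * F t k) + eps t ω := funext (hY0 t ht)
    rw [h]
    exact (integrable_finsetSum _ (fun k _ => (hLamInt k).mul_const _)).add (hepsInt t ht)
  -- group integrals of the untreated outcomes
  have hYval : ∀ t ∈ Finset.Icc 1 T, ∀ j ≤ K, ∫ ω in {ω | G ω = j}, Y0 t ω ∂P
      = ∑ k, (∫ ω in {ω | G ω = j}, Lam ω k ∂P) * F t k := by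
    intro t ht j hj
    have h : Y0 t = fun ω => (∑ k, Lam ω k * F t k) + eps t ω := funext (hY0 t ht)
    have hi : ∀ k ∈ (Finset.univ : Finset (Fin M)),
        Integrable (fun ω => Lam ω k * F t k) (P.restrict {ω | G ω = j}) :=
      fun k _ => ((hLamInt k).mul_const _).restrict
    rw [h, integral_add (integrable_finsetSum _ hi) (hepsInt t ht).restrict,
      hepsMean t ht j hj, add_zero, integral_finsetSum _ hi]
    exact Finset.sum_congr rfl (fun k _ => integral_mul_const _ _)
  have hcell : ∀ lam' : ℕ → ℝ, ∀ t ∈ Finset.Icc Tstar T, ∀ j ≤ K,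
      cExp P (fun ω => Y0 t ω - ∑ s ∈ Finset.Icc 1 (Tstar - 1), lam' s * Y0 s ω) {ω | G ω = j}
      = ∑ k, cExp P (fun ω => Lam ω k) {ω | G ω = j} *
          (F t k - ∑ s ∈ Finset.Icc 1 (Tstar - 1), lam' s * F s k) := by
    intro lam' t ht j hj
    have hi : ∀ s ∈ Finset.Icc 1 (Tstar - 1),
        Integrable (fun ω => lam' s * Y0 s ω) (P.restrict {ω | G ω = j}) :=
      fun s hs => ((hYint s (hIccT s hs)).const_mul _).restrict
    unfold cExp
    rw [integral_sub (hYint t (hpost t ht)).restrict (integrable_finsetSum _ hi),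
      integral_finsetSum _ hi, hYval t (hpost t ht) j hj]
    have h2 : ∑ s ∈ Finset.Icc 1 (Tstar - 1), ∫ ω in {ω | G ω = j}, lam' s * Y0 s ω ∂P
        = ∑ k, (∫ ω in {ω | G ω = j}, Lam ω k ∂P) *
            ∑ s ∈ Finset.Icc 1 (Tstar - 1), lam' s * F s k := by
      simp_rw [Finset.mul_sum]
      rw [Finset.sum_comm]
      refine Finset.sum_congr rfl (fun s hs => ?_)
      rw [integral_const_mul, hYval s (hIccT s hs) j hj, Finset.mul_sum]
      exact Finset.sum_congr rfl (fun k _ => by ring)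
    rw [h2, ← Finset.sum_sub_distrib, Finset.sum_div]
    exact Finset.sum_congr rfl (fun k _ => by ring)
  have hkey : ∀ lam' : ℕ → ℝ, ∀ t ∈ Finset.Icc Tstar T,
      eErr P G Y0 K (Tstar - 1) lam' w t
      = ∑ k, (F t k - ∑ s ∈ Finset.Icc 1 (Tstar - 1), lam' s * F s k) *
          (cExp P (fun ω => Lam ω k) {ω | G ω = 0}
            - ∑ j ∈ Finset.Icc 1 K, w j * cExp P (fun ω => Lam ω k) {ω | G ω = j}) := by
    intro lam' t ht
    unfold eErr
    rw [hcell lam' t ht 0 (Nat.zero_le _)]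
    have h2 : ∑ j ∈ Finset.Icc 1 K, w j * cExp P
          (fun ω => Y0 t ω - ∑ s ∈ Finset.Icc 1 (Tstar - 1), lam' s * Y0 s ω) {ω | G ω = j}
        = ∑ k, (F t k - ∑ s ∈ Finset.Icc 1 (Tstar - 1), lam' s * F s k) *
          ∑ j ∈ Finset.Icc 1 K, w j * cExp P (fun ω => Lam ω k) {ω | G ω = j} := by
      simp_rw [Finset.mul_sum (s := Finset.Icc 1 K)]
      rw [Finset.sum_comm]
      refine Finset.sum_congr rfl (fun j hj => ?_)
      rw [hcell lam' t ht j (Finset.mem_Icc.mp hj).2, Finset.mul_sum]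
      exact Finset.sum_congr rfl (fun k _ => by ring)
    rw [h2, ← Finset.sum_sub_distrib]
    exact Finset.sum_congr rfl (fun k _ => by ring)
  have h31 : (∀ k : Fin M, cExp P (fun ω => Lam ω k) {ω | G ω = 0}
          = ∑ j ∈ Finset.Icc 1 K, w j * cExp P (fun ω => Lam ω k) {ω | G ω = j}) →
      (∀ lam' : ℕ → ℝ, (∀ s ∈ Finset.Icc 1 (Tstar - 1), 0 ≤ lam' s) →
        (∑ s ∈ Finset.Icc 1 (Tstar - 1), lam' s = 1) →
        ∀ t ∈ Finset.Icc Tstar T, eErr P G Y0 K (Tstar - 1) lam' w t = 0) := by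
    intro h lam' _ _ t ht
    rw [hkey lam' t ht]
    exact Finset.sum_eq_zero (fun k _ => by rw [h k, sub_self, mul_zero])
  have h13 : (∀ t ∈ Finset.Icc Tstar T, eErr P G Y0 K (Tstar - 1) lam w t = 0) →
      (∀ k : Fin M, cExp P (fun ω => Lam ω k) {ω | G ω = 0}
          = ∑ j ∈ Finset.Icc 1 K, w j * cExp P (fun ω => Lam ω k) {ω | G ω = j}) := by
    intro h
    have hall : ∀ v : Fin M → ℝ, ∑ k, v k * (cExp P (fun ω => Lam ω k) {ω | G ω = 0}
            - ∑ j ∈ Finset.Icc 1 K, w j * cExp P (fun ω => Lam ω k) {ω | G ω = j}) = 0 := by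
      intro v
      have hv : v ∈ Submodule.span ℝ
        ((fun t => fun k => F t k - ∑ s ∈ Finset.Icc 1 (Tstar - 1), lam s * F s k) ''
          (Finset.Icc Tstar T : Finset ℕ)) := by
        rw [hSpan]
        exact Submodule.mem_top
      induction hv using Submodule.span_induction with
      | mem x hx =>
        obtain ⟨t, ht, rfl⟩ := hx
        have ht2 : t ∈ Finset.Icc Tstar T := Finset.mem_coe.mp ht
        rw [← hkey lam t ht2]
        exact h t ht2
      | zero => simp
      | add x y _ _ hx hy =>
        simp only [Pi.add_apply, add_mul, Finset.sum_add_distrib, hx, hy, add_zero]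
      | smul a x _ hx =>
        simp only [Pi.smul_apply, smul_eq_mul, mul_assoc, ← Finset.mul_sum, hx, mul_zero]
    intro k
    have := hall (Pi.single k 1)
    simp only [Pi.single_apply, ite_mul, one_mul, zero_mul, Finset.sum_ite_eq',
      Finset.mem_univ, if_true] at this
    exact sub_eq_zero.mp this
  exact ⟨⟨fun h => h31 (h13 h), fun h => h lam hlam0 hlam1⟩,
    ⟨fun h => h13 (h lam hlam0 hlam1), h31⟩⟩

end
end

section
/- PTA-I holds if and only if GMC holds at (λ^DID, w^DID). -/
open MeasureTheory Classical

noncomputable section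

/-- The DID matching error `e_t^DID(λ)` of the target group against the pooled donor
groups `{1,…,K}`, with `p` pre-treatment periods. -/
def eDID {Ω : Type*} [MeasurableSpace Ω] (P : Measure Ω) (G : Ω → ℕ)
    (Y0 : ℕ → Ω → ℝ) (K p : ℕ) (lam : ℕ → ℝ) (t : ℕ) : ℝ :=
  cExp P (fun ω => Y0 t ω - ∑ s ∈ Finset.Icc 1 p, lam s * Y0 s ω) {ω | G ω = 0}
    - cExp P (fun ω => Y0 t ω - ∑ s ∈ Finset.Icc 1 p, lam s * Y0 s ω)
        {ω | G ω ∈ Finset.Icc 1 K}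

/-- The groupwise DID matching error `e_{j,t}^DID(λ)` of the target group against donor
group `j`, with `p` pre-treatment periods. -/
def ejDID {Ω : Type*} [MeasurableSpace Ω] (P : Measure Ω) (G : Ω → ℕ)
    (Y0 : ℕ → Ω → ℝ) (p : ℕ) (lam : ℕ → ℝ) (j t : ℕ) : ℝ :=
  cExp P (fun ω => Y0 t ω - ∑ s ∈ Finset.Icc 1 p, lam s * Y0 s ω) {ω | G ω = 0}
    - cExp P (fun ω => Y0 t ω - ∑ s ∈ Finset.Icc 1 p, lam s * Y0 s ω) {ω | G ω = j}

lemma cExp_sub_aux {Ω : Type*} [MeasurableSpace Ω] (P : Measure Ω) (X Y : Ω → ℝ) (A : Set Ω)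
    (hX : Integrable X P) (hY : Integrable Y P) :
    cExp P (fun ω => X ω - Y ω) A = cExp P X A - cExp P Y A := by
  unfold cExp
  rw [integral_sub hX.integrableOn hY.integrableOn, sub_div]

lemma cExp_pool_aux {Ω : Type*} [MeasurableSpace Ω] (P : Measure Ω) [IsProbabilityMeasure P]
    (K : ℕ) (G : Ω → ℕ) (hGmeas : Measurable G)
    (hPG : ∀ j ≤ K, 0 < P {ω | G ω = j}) (X : Ω → ℝ) (hX : Integrable X P) :
    ∑ j ∈ Finset.Icc 1 K, (P {ω | G ω = j}).toReal / (P {ω | G ω ∈ Finset.Icc 1 K}).toReal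
      * cExp P X {ω | G ω = j} = cExp P X {ω | G ω ∈ Finset.Icc 1 K} := by
  have hU : {ω | G ω ∈ Finset.Icc 1 K} = ⋃ j ∈ Finset.Icc 1 K, {ω | G ω = j} := by
    ext ω; simp
  have hI : ∫ ω in {ω | G ω ∈ Finset.Icc 1 K}, X ω ∂P
      = ∑ j ∈ Finset.Icc 1 K, ∫ ω in {ω | G ω = j}, X ω ∂P := by
    rw [hU]
    refine integral_biUnion_finset _ (fun j _ => hGmeas (measurableSet_singleton j)) ?_
      (fun j _ => hX.integrableOn)
    intro i _ j _ hij
    refine Set.disjoint_left.mpr ?_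
    intro ω h1 h2
    exact hij (h1.symm.trans h2)
  unfold cExp
  rw [hI, Finset.sum_div]
  refine Finset.sum_congr rfl fun j hj => ?_
  have h0 : (P {ω | G ω = j}).toReal ≠ 0 :=
    (ENNReal.toReal_pos (hPG j (Finset.mem_Icc.mp hj).2).ne' (measure_ne_top _ _)).ne'
  field_simp

/-- PTA-I holds if and only if GMC holds at `(λ^DID, w^DID)`. -/
theorem ptaI_iff_gmc_lamDID_wDID
    {Ω : Type*} [MeasurableSpace Ω] (P : Measure Ω) [IsProbabilityMeasure P]
    (T Tstar K : ℕ) (hT : 2 ≤ T) (hTstar : 1 < Tstar) (hTsT : Tstar ≤ T) (hK : 1 ≤ K)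
    (G : Ω → ℕ) (hGmeas : Measurable G) (hGrange : ∀ ω, G ω ≤ K)
    (hPG : ∀ j ≤ K, 0 < P {ω | G ω = j})
    (Y0 : ℕ → Ω → ℝ) (hY0int : ∀ t ∈ Finset.Icc 1 T, Integrable (Y0 t) P)
    :
    -- PTA-I
    (∀ t ∈ Finset.Icc Tstar T,
        cExp P (fun ω => Y0 t ω - Y0 (t - 1) ω) {ω | G ω = 0}
          = cExp P (fun ω => Y0 t ω - Y0 (t - 1) ω) {ω | G ω ∈ Finset.Icc 1 K})
    ↔
    -- GMC at (λ^DID, w^DID)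
    (∀ t ∈ Finset.Icc Tstar T,
        eErr P G Y0 K (Tstar - 1) (fun s => if s = Tstar - 1 then (1 : ℝ) else 0)
          (fun j => (P {ω | G ω = j}).toReal
              / (P {ω | G ω ∈ Finset.Icc 1 K}).toReal) t = 0) := by
  have hl : ∀ t, (fun ω => Y0 t ω - ∑ s ∈ Finset.Icc 1 (Tstar - 1),
      (if s = Tstar - 1 then (1 : ℝ) else 0) * Y0 s ω)
      = fun ω => Y0 t ω - Y0 (Tstar - 1) ω := by
    intro t
    funext ω
    have h1 : Tstar - 1 ∈ Finset.Icc 1 (Tstar - 1) := Finset.mem_Icc.mpr ⟨by omega, le_rfl⟩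
    congr 1
    rw [Finset.sum_eq_single_of_mem _ h1]
    · simp
    · intro b _ hb
      simp [hb]
  have hint : ∀ t, 1 ≤ t → t ≤ T → Integrable (Y0 t) P :=
    fun t h1 h2 => hY0int t (Finset.mem_Icc.mpr ⟨h1, h2⟩)
  have hE : ∀ t, Tstar ≤ t → t ≤ T →
      eErr P G Y0 K (Tstar - 1) (fun s => if s = Tstar - 1 then (1 : ℝ) else 0)
          (fun j => (P {ω | G ω = j}).toReal
              / (P {ω | G ω ∈ Finset.Icc 1 K}).toReal) t
        = (cExp P (Y0 t) {ω | G ω = 0} - cExp P (Y0 (Tstar - 1)) {ω | G ω = 0})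
          - (cExp P (Y0 t) {ω | G ω ∈ Finset.Icc 1 K}
            - cExp P (Y0 (Tstar - 1)) {ω | G ω ∈ Finset.Icc 1 K}) := by
    intro t h1 h2
    have i1 := hint t (by omega) h2
    have i2 := hint (Tstar - 1) (by omega) (by omega)
    unfold eErr
    simp only [hl]
    rw [cExp_pool_aux P K G hGmeas hPG (fun ω => Y0 t ω - Y0 (Tstar - 1) ω) (i1.sub i2), cExp_sub_aux P _ _ _ i1 i2,
      cExp_sub_aux P _ _ _ i1 i2]
  have hS : ∀ t A, Tstar ≤ t → t ≤ T → cExp P (fun ω => Y0 t ω - Y0 (t - 1) ω) A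
      = cExp P (Y0 t) A - cExp P (Y0 (t - 1)) A := fun t A h1 h2 =>
    cExp_sub_aux P _ _ _ (hint t (by omega) h2) (hint (t - 1) (by omega) (by omega))
  constructor
  · intro h t ht
    obtain ⟨h1, h2⟩ := Finset.mem_Icc.mp ht
    rw [hE t h1 h2]
    clear ht
    induction t, h1 using Nat.le_induction with
    | base =>
      have := h Tstar (Finset.mem_Icc.mpr ⟨le_rfl, hTsT⟩)
      rw [hS _ _ le_rfl hTsT, hS _ _ le_rfl hTsT] at this
      linarith
    | succ n hn ih =>
      have hn' : Tstar ≤ n + 1 := by omega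
      have := h (n + 1) (Finset.mem_Icc.mpr ⟨hn', h2⟩)
      rw [hS _ _ hn' h2, hS _ _ hn' h2, Nat.add_sub_cancel] at this
      have := ih (by omega)
      linarith
  · intro h t ht
    obtain ⟨h1, h2⟩ := Finset.mem_Icc.mp ht
    rw [hS _ _ h1 h2, hS _ _ h1 h2]
    have e1 := h t ht
    rw [hE t h1 h2] at e1
    rcases Nat.eq_or_lt_of_le h1 with he | hlt
    · subst he
      linarith
    · have e2 := h (t - 1) (Finset.mem_Icc.mpr ⟨by omega, by omega⟩)
      rw [hE (t - 1) (by omega) (by omega)] at e2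
      linarith

end
end

section
/- Fix λ ∈ Δ_{|𝒯₀|−1} and suppose e_{j,T*−1}^DID(λ) = 0 for every j ∈ 𝒢_don. Then PTA-II holds if and only if PTA-U(λ) holds. -/
open MeasureTheory Classical

noncomputable section

/-- If `e_{j,T*−1}^DID(λ) = 0` for every donor `j`, then PTA-II
holds iff PTA-U(λ) holds. -/
theorem ptaII_iff_ptaULam
    {Ω : Type*} [MeasurableSpace Ω] (P : Measure Ω) [IsProbabilityMeasure P]
    (T Tstar K : ℕ) (hT : 2 ≤ T) (hTstar : 1 < Tstar) (hTsT : Tstar ≤ T) (hK : 1 ≤ K)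
    (G : Ω → ℕ) (hGmeas : Measurable G) (hGrange : ∀ ω, G ω ≤ K)
    (hPG : ∀ j ≤ K, 0 < P {ω | G ω = j})
    (Y0 : ℕ → Ω → ℝ) (hY0int : ∀ t ∈ Finset.Icc 1 T, Integrable (Y0 t) P)
    (lam : ℕ → ℝ) (hlam0 : ∀ s ∈ Finset.Icc 1 (Tstar - 1), 0 ≤ lam s)
    (hlam1 : ∑ s ∈ Finset.Icc 1 (Tstar - 1), lam s = 1)
    (hbase : ∀ j ∈ Finset.Icc 1 K, ejDID P G Y0 (Tstar - 1) lam j (Tstar - 1) = 0) :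
    -- PTA-II
    (∀ t ∈ Finset.Icc Tstar T, ∀ j ∈ Finset.Icc 1 K,
        cExp P (fun ω => Y0 t ω - Y0 (t - 1) ω) {ω | G ω = 0}
          = cExp P (fun ω => Y0 t ω - Y0 (t - 1) ω) {ω | G ω = j})
    ↔
    -- PTA-U(λ)
    (∀ j ∈ Finset.Icc 1 K, ∀ t ∈ Finset.Icc Tstar T,
        ejDID P G Y0 (Tstar - 1) lam j t = 0) := by
  have hS : Integrable (fun ω => ∑ s ∈ Finset.Icc 1 (Tstar - 1), lam s * Y0 s ω) P := by
    refine integrable_finsetSum _ fun s hs => ?_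
    rw [Finset.mem_Icc] at hs
    exact (hY0int s (Finset.mem_Icc.2 ⟨hs.1, by omega⟩)).const_mul _
  have key : ∀ t ∈ Finset.Icc Tstar T, ∀ j,
      ejDID P G Y0 (Tstar - 1) lam j t - ejDID P G Y0 (Tstar - 1) lam j (t - 1)
        = cExp P (fun ω => Y0 t ω - Y0 (t - 1) ω) {ω | G ω = 0}
          - cExp P (fun ω => Y0 t ω - Y0 (t - 1) ω) {ω | G ω = j} := by
    intro t ht j
    rw [Finset.mem_Icc] at ht
    have h1 := hY0int t (Finset.mem_Icc.2 ⟨by omega, ht.2⟩)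
    have h2 := hY0int (t - 1) (Finset.mem_Icc.2 ⟨by omega, by omega⟩)
    unfold ejDID
    simp only [cExp_sub_aux P _ _ _ h1 hS, cExp_sub_aux P _ _ _ h2 hS,
      cExp_sub_aux P _ _ _ h1 h2]
    ring
  constructor
  · intro h j hj
    have main : ∀ t, Tstar - 1 ≤ t → t ≤ T → ejDID P G Y0 (Tstar - 1) lam j t = 0 := by
      intro t ht
      induction t, ht using Nat.le_induction with
      | base => intro _; exact hbase j hj
      | succ n hn ih =>
        intro hnT
        have hmem : n + 1 ∈ Finset.Icc Tstar T := Finset.mem_Icc.2 ⟨by omega, hnT⟩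
        have k := key (n + 1) hmem j
        have e := h (n + 1) hmem j hj
        have i := ih (by omega)
        rw [Nat.add_sub_cancel] at k e
        linarith
    intro t ht
    rw [Finset.mem_Icc] at ht
    exact main t (by omega) ht.2
  · intro h t ht j hj
    have k := key t ht j
    have a := h j hj t ht
    have b : ejDID P G Y0 (Tstar - 1) lam j (t - 1) = 0 := by
      rw [Finset.mem_Icc] at ht
      rcases Nat.eq_or_lt_of_le ht.1 with e | e
      · rw [← e]; exact hbase j hj
      · exact h j hj (t - 1) (Finset.mem_Icc.2 ⟨by omega, by omega⟩)
    linarith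

end
end

section
/- Suppose m̄ > 0 and |μ_{j,t}| ≤ m̄ for all j ∈ {0,1,…,K} and all t ∈ {1,…,p}. Then for any ŵ, w̃ ∈ Δ_{K−1}: (η̂₀(w̃) − η₀(w̃)) − (η̂₀(ŵ) − η₀(ŵ)) ≤ 4·(D̂_{0,2}² + 3·m̄·D̂_{0,1}) · Σ_{j=1}^K |ŵ_j − w̃_j|. -/
noncomputable section

theorem ssme_aux_abs {K : ℕ} (a v : Fin K → ℝ) (M : ℝ) (h : ∀ j, |a j| ≤ M) :
    |∑ j, a j * v j| ≤ M * ∑ j, |v j| := by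
  rw [Finset.mul_sum]
  refine (Finset.abs_sum_le_sum_abs _ _).trans (Finset.sum_le_sum fun j _ => ?_)
  rw [abs_mul]
  exact mul_le_mul_of_nonneg_right (h j) (abs_nonneg _)

theorem ssme_aux_simplex {K : ℕ} (a0 : ℝ) (a v : Fin K → ℝ) (M : ℝ) (h0 : |a0| ≤ M)
    (h : ∀ j, |a j| ≤ M) (hv : ∀ j, 0 ≤ v j) (hs : ∑ j, v j = 1) :
    |a0 - ∑ j, a j * v j| ≤ 2 * M := by
  have h1 := ssme_aux_abs a v M h
  have h2 : ∑ j, |v j| = 1 := by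
    rw [← hs]
    exact Finset.sum_congr rfl fun j _ => abs_of_nonneg (hv j)
  rw [h2] at h1
  have h3 := abs_sub a0 (∑ j, a j * v j)
  linarith

theorem ssme_aux_diff {K : ℕ} (a0 : ℝ) (a v u : Fin K → ℝ) (M : ℝ)
    (h : ∀ j, |a j| ≤ M) :
    |(a0 - ∑ j, a j * v j) - (a0 - ∑ j, a j * u j)| ≤ M * ∑ j, |u j - v j| := by
  have h1 := ssme_aux_abs a (fun j => u j - v j) M h
  have h2 : (a0 - ∑ j, a j * v j) - (a0 - ∑ j, a j * u j) = ∑ j, a j * (u j - v j) := by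
    simp only [mul_sub, Finset.sum_sub_distrib]
    ring
  rw [h2]
  exact h1

theorem ssme_aux_mul {x y a b : ℝ} (hx : |x| ≤ a) (hy : |y| ≤ b) : x * y ≤ a * b := by
  refine (le_abs_self _).trans ?_
  rw [abs_mul]
  exact mul_le_mul hx hy (abs_nonneg _) ((abs_nonneg _).trans hx)

theorem ssme_aux_period {K : ℕ} (a0 b0 : ℝ) (a b : Fin K → ℝ) (m : ℝ) (hm : 0 < m)
    (ha0 : |a0| ≤ m) (ha : ∀ j, |a j| ≤ m) (u v : Fin K → ℝ)
    (hu : ∀ j, 0 ≤ u j) (hus : ∑ j, u j = 1) (hv : ∀ j, 0 ≤ v j) (hvs : ∑ j, v j = 1) :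
    ((b0 - ∑ j, b j * v j) ^ 2 - (a0 - ∑ j, a j * v j) ^ 2)
      - ((b0 - ∑ j, b j * u j) ^ 2 - (a0 - ∑ j, a j * u j) ^ 2)
      ≤ 4 * (((b0 - a0) ^ 2 + ∑ j, (b j - a j) ^ 2)
        + 3 * m * (|b0 - a0| + ∑ j, |b j - a j|)) * ∑ j, |u j - v j| := by
  set S2 := (b0 - a0) ^ 2 + ∑ j, (b j - a j) ^ 2 with hS2
  set S1 := |b0 - a0| + ∑ j, |b j - a j| with hS1
  set L := ∑ j, |u j - v j| with hL
  have hL0 : 0 ≤ L := Finset.sum_nonneg fun j _ => abs_nonneg _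
  have hq : 0 ≤ ∑ j, (b j - a j) ^ 2 := Finset.sum_nonneg fun j _ => sq_nonneg _
  have hl : 0 ≤ ∑ j, |b j - a j| := Finset.sum_nonneg fun j _ => abs_nonneg _
  have hS20 : 0 ≤ S2 := by positivity
  have hS10 : 0 ≤ S1 := by positivity
  have h10 : |b0 - a0| ≤ S1 := by linarith
  have h1 : ∀ j, |b j - a j| ≤ S1 := fun j => by
    have := Finset.single_le_sum (f := fun j => |b j - a j|)
      (fun i _ => abs_nonneg _) (Finset.mem_univ j)
    have h' := abs_nonneg (b0 - a0)
    linarith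
  have h20 : |b0 - a0| ≤ √S2 := Real.abs_le_sqrt (by linarith)
  have h2 : ∀ j, |b j - a j| ≤ √S2 := fun j => by
    have := Finset.single_le_sum (f := fun j => (b j - a j) ^ 2)
      (fun i _ => sq_nonneg _) (Finset.mem_univ j)
    have h' := sq_nonneg (b0 - a0)
    exact Real.abs_le_sqrt (by linarith)
  have key : ∀ w : Fin K → ℝ, b0 - ∑ j, b j * w j
      = (a0 - ∑ j, a j * w j) + ((b0 - a0) - ∑ j, (b j - a j) * w j) := fun w => by
    simp only [sub_mul, Finset.sum_sub_distrib]
    ring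
  rw [key u, key v]
  have ev := ssme_aux_simplex a0 a v m ha0 ha hv hvs
  have ed := ssme_aux_diff a0 a v u m ha
  have fu1 := ssme_aux_simplex (b0 - a0) (fun j => b j - a j) u S1 h10 h1 hu hus
  have fd1 := ssme_aux_diff (b0 - a0) (fun j => b j - a j) v u S1 h1
  have fu2 := ssme_aux_simplex (b0 - a0) (fun j => b j - a j) u (√S2) h20 h2 hu hus
  have fv2 := ssme_aux_simplex (b0 - a0) (fun j => b j - a j) v (√S2) h20 h2 hv hvs
  have fd2 := ssme_aux_diff (b0 - a0) (fun j => b j - a j) v u (√S2) h2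
  rw [← hL] at ed fd1 fd2
  generalize (b0 - a0) - ∑ j, (b j - a j) * u j = fu at *
  generalize (b0 - a0) - ∑ j, (b j - a j) * v j = fv at *
  generalize a0 - ∑ j, a j * u j = eu at *
  generalize a0 - ∑ j, a j * v j = ew at *
  have t1 := ssme_aux_mul ev fd1
  have t2 := ssme_aux_mul ed fu1
  have fs : |fv + fu| ≤ 4 * √S2 := by
    have := abs_add_le fv fu
    linarith
  have t3 := ssme_aux_mul fd2 fs
  have t4 : √S2 * L * (4 * √S2) = 4 * S2 * L := by
    have := Real.mul_self_sqrt hS20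
    linear_combination 4 * L * this
  have t5 : 0 ≤ m * S1 * L := by positivity
  nlinarith

/-- If `|μ_{j,t}| ≤ m̄` for all groups and pre-treatment periods,
then for any `ŵ, w̃` in the simplex,
`(η̂₀(w̃) − η₀(w̃)) − (η̂₀(ŵ) − η₀(ŵ)) ≤ 4(D̂_{0,2}² + 3 m̄ D̂_{0,1}) Σ_j |ŵ_j − w̃_j|`. -/
theorem ssme_difference_bound
    (K p : ℕ) (hK : 1 ≤ K) (hp : 1 ≤ p)
    (μ0 : Fin p → ℝ) (μ : Fin K → Fin p → ℝ)
    (μ0hat : Fin p → ℝ) (μhat : Fin K → Fin p → ℝ)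
    (η₀ η₀hat D1 D2sq : _)
    (hη₀ : η₀ = fun w : Fin K → ℝ =>
      (1 / (p : ℝ)) * ∑ t : Fin p, (μ0 t - ∑ j : Fin K, μ j t * w j) ^ 2)
    (hη₀hat : η₀hat = fun w : Fin K → ℝ =>
      (1 / (p : ℝ)) * ∑ t : Fin p, (μ0hat t - ∑ j : Fin K, μhat j t * w j) ^ 2)
    (hD1 : D1 = (1 / (p : ℝ)) * ∑ t : Fin p,
      (|μ0hat t - μ0 t| + ∑ j : Fin K, |μhat j t - μ j t|))
    (hD2sq : D2sq = (1 / (p : ℝ)) * ∑ t : Fin p,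
      ((μ0hat t - μ0 t) ^ 2 + ∑ j : Fin K, (μhat j t - μ j t) ^ 2))
    (mbar : ℝ) (hmbar : 0 < mbar)
    (hμ0 : ∀ t, |μ0 t| ≤ mbar) (hμ : ∀ j t, |μ j t| ≤ mbar) :
    ∀ what wtil : Fin K → ℝ,
      (∀ j, 0 ≤ what j) → (∑ j : Fin K, what j = 1) →
      (∀ j, 0 ≤ wtil j) → (∑ j : Fin K, wtil j = 1) →
      (η₀hat wtil - η₀ wtil) - (η₀hat what - η₀ what)
        ≤ 4 * (D2sq + 3 * mbar * D1) * ∑ j : Fin K, |what j - wtil j| := by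
  intro u v hu hus hv hvs
  subst hη₀ hη₀hat hD1 hD2sq
  have hs := Finset.sum_le_sum fun (t : Fin p) (_ : t ∈ Finset.univ) =>
    ssme_aux_period (μ0 t) (μ0hat t) (fun j => μ j t) (fun j => μhat j t) mbar hmbar
      (hμ0 t) (fun j => hμ j t) u v hu hus hv hvs
  rw [← Finset.sum_mul, ← Finset.mul_sum, Finset.sum_add_distrib, ← Finset.mul_sum,
    Finset.sum_sub_distrib, Finset.sum_sub_distrib, Finset.sum_sub_distrib] at hs
  have hp' : (0 : ℝ) ≤ 1 / (p : ℝ) := by positivity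
  have := mul_le_mul_of_nonneg_left hs hp'
  simp only
  linarith

end
end

section
/- Suppose m̄ > 0, c > 0, |μ_{j,t}| ≤ m̄ for all j ∈ {0,1,…,K} and t ∈ {1,…,p}, and λ_min(ΓᵀΓ) ≥ c·p. Let ŵ ∈ Δ_{K−1} be a minimizer of η̂₀ over Δ_{K−1} and w* ∈ Δ_{K−1} a minimizer of η₀ over Δ_{K−1}. Then Σ_{j=1}^K |ŵ_j − w*_j| ≤ 4·K·(D̂_{0,2}² + 3·m̄·D̂_{0,1}) / c. -/
open Matrix

noncomputable section

theorem aux_var {p : ℕ} (x y : Fin p → ℝ)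
    (h : ∀ s : ℝ, 0 ≤ s → s ≤ 1 → ∑ t, x t ^ 2 ≤ ∑ t, (x t - s * y t) ^ 2) :
    ∑ t, x t * y t ≤ 0 := by
  by_contra hP
  push Not at hP
  set P := ∑ t, x t * y t with hPdef
  have hQ : 0 ≤ ∑ t, y t ^ 2 := Finset.sum_nonneg fun t _ => sq_nonneg _
  set Q := ∑ t, y t ^ 2 with hQdef
  have hPQ : 0 < P + Q := by linarith
  have key : ∀ s : ℝ, ∑ t, (x t - s * y t) ^ 2 = ∑ t, x t ^ 2 - 2 * s * P + s ^ 2 * Q := by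
    intro s
    rw [hPdef, hQdef, Finset.mul_sum, Finset.mul_sum, ← Finset.sum_sub_distrib,
      ← Finset.sum_add_distrib]
    exact Finset.sum_congr rfl fun t _ => by ring
  have hs0 : 0 < P / (P + Q) := div_pos hP hPQ
  have hs1 : P / (P + Q) ≤ 1 := by rw [div_le_one hPQ]; linarith
  have h1 := h _ hs0.le hs1
  rw [key] at h1
  have h2 : P / (P + Q) * (P + Q) = P := div_mul_cancel₀ _ hPQ.ne'
  set s := P / (P + Q)
  have h3 : 0 < s * P := mul_pos hs0 hP
  have h4 : s ^ 2 * Q = s * P - s * (s * P) := by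
    have : s * Q = P - s * P := by linarith
    rw [pow_two, mul_assoc, this]; ring
  have h5 : 0 < s * (s * P) := mul_pos hs0 h3
  linarith

theorem aux_eig {K : ℕ} (A : Matrix (Fin K) (Fin K) ℝ) (hA : A.IsHermitian) (a : ℝ)
    (h : ∀ i, a ≤ hA.eigenvalues i) (d : Fin K → ℝ) :
    a * ∑ j, d j ^ 2 ≤ d ⬝ᵥ (A *ᵥ d) := by
  have hps : (A - a • (1 : Matrix (Fin K) (Fin K) ℝ)).PosSemidef := by
    have hD : (Matrix.diagonal fun i => hA.eigenvalues i - a).PosSemidef :=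
      Matrix.PosSemidef.diagonal fun i => sub_nonneg.2 (h i)
    have hU := hD.mul_mul_conjTranspose_same (hA.eigenvectorUnitary : Matrix (Fin K) (Fin K) ℝ)
    convert hU using 1
    have e1 : (Matrix.diagonal fun i => hA.eigenvalues i - a)
        = Matrix.diagonal (fun i => hA.eigenvalues i) - a • (1 : Matrix (Fin K) (Fin K) ℝ) := by
      ext i j
      by_cases hij : i = j
      · subst hij; simp
      · simp [hij]
    have e2 := hA.spectral_theorem
    have e3 : (hA.eigenvectorUnitary : Matrix (Fin K) (Fin K) ℝ)
        * (hA.eigenvectorUnitary : Matrix (Fin K) (Fin K) ℝ)ᴴ = 1 :=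
      Unitary.coe_mul_star_self _
    rw [e1, mul_sub, sub_mul, mul_smul_comm, smul_mul_assoc, mul_one, e3]
    congr 1
  have := hps.dotProduct_mulVec_nonneg d
  rw [Matrix.sub_mulVec, dotProduct_sub, Matrix.smul_mulVec, Matrix.one_mulVec,
    dotProduct_smul] at this
  have e : star d ⬝ᵥ d = ∑ j, d j ^ 2 := by
    simp [dotProduct, pow_two]
  rw [e] at this
  simpa using this


set_option maxHeartbeats 1000000 in
/-- Under boundedness of the group means and the eigenvalue condition
`λ_min(ΓᵀΓ) ≥ c·p`, the SCD weight estimate `ŵ` (minimizing the sample pre-treatment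
SSME) satisfies `Σ_j |ŵ_j − w*_j| ≤ 4K(D̂_{0,2}² + 3 m̄ D̂_{0,1})/c`, where `w*`
minimizes the population pre-treatment SSME. -/
theorem scd_weight_estimation_bound
    (K p : ℕ) (hK : 1 ≤ K) (hp : 1 ≤ p)
    (μ0 : Fin p → ℝ) (μ : Fin K → Fin p → ℝ)
    (μ0hat : Fin p → ℝ) (μhat : Fin K → Fin p → ℝ)
    (η₀ η₀hat D1 D2sq : _)
    (hη₀ : η₀ = fun w : Fin K → ℝ =>
      (1 / (p : ℝ)) * ∑ t : Fin p, (μ0 t - ∑ j : Fin K, μ j t * w j) ^ 2)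
    (hη₀hat : η₀hat = fun w : Fin K → ℝ =>
      (1 / (p : ℝ)) * ∑ t : Fin p, (μ0hat t - ∑ j : Fin K, μhat j t * w j) ^ 2)
    (hD1 : D1 = (1 / (p : ℝ)) * ∑ t : Fin p,
      (|μ0hat t - μ0 t| + ∑ j : Fin K, |μhat j t - μ j t|))
    (hD2sq : D2sq = (1 / (p : ℝ)) * ∑ t : Fin p,
      ((μ0hat t - μ0 t) ^ 2 + ∑ j : Fin K, (μhat j t - μ j t) ^ 2))
    (mbar c : ℝ) (hmbar : 0 < mbar) (hc : 0 < c)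
    (hμ0 : ∀ t, |μ0 t| ≤ mbar) (hμ : ∀ j t, |μ j t| ≤ mbar)
    (hHerm : ((Matrix.of fun (t : Fin p) (j : Fin K) => μ j t)ᵀ
        * (Matrix.of fun (t : Fin p) (j : Fin K) => μ j t)).IsHermitian)
    (hEig : ∀ i : Fin K, c * (p : ℝ) ≤ hHerm.eigenvalues i)
    (what : Fin K → ℝ)
    (hwhat_mem : (∀ j, 0 ≤ what j) ∧ ∑ j : Fin K, what j = 1)
    (hwhat_min : ∀ w : Fin K → ℝ, (∀ j, 0 ≤ w j) → (∑ j : Fin K, w j = 1) →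
      η₀hat what ≤ η₀hat w)
    (wstar : Fin K → ℝ)
    (hwstar_mem : (∀ j, 0 ≤ wstar j) ∧ ∑ j : Fin K, wstar j = 1)
    (hwstar_min : ∀ w : Fin K → ℝ, (∀ j, 0 ≤ w j) → (∑ j : Fin K, w j = 1) →
      η₀ wstar ≤ η₀ w) :
    ∑ j : Fin K, |what j - wstar j| ≤ 4 * (K : ℝ) * (D2sq + 3 * mbar * D1) / c := by
  have hp0 : (0 : ℝ) < p := by exact_mod_cast hp
  obtain ⟨hw0, hw1⟩ := hwhat_mem
  obtain ⟨hv0, hv1⟩ := hwstar_mem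
  set d : Fin K → ℝ := fun j => what j - wstar j with hd
  set G : Fin p → ℝ := fun t => ∑ j, μ j t * d j with hG
  set Gh : Fin p → ℝ := fun t => ∑ j, μhat j t * d j with hGh
  set e : Fin p → ℝ := fun t => μ0 t - ∑ j, μ j t * what j with he
  set es : Fin p → ℝ := fun t => μ0 t - ∑ j, μ j t * wstar j with hes
  set eh : Fin p → ℝ := fun t => μ0hat t - ∑ j, μhat j t * what j with heh
  set L : ℝ := ∑ j, |d j| with hL
  have hL0 : 0 ≤ L := Finset.sum_nonneg fun j _ => abs_nonneg _
  have V1 : ∑ t, es t * G t ≤ 0 := by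
    apply aux_var
    intro s hs0 hs1
    have hm := hwstar_min (fun j => wstar j + s * d j)
      (fun j => by
        have := hw0 j
        have := hv0 j
        have : wstar j + s * d j = (1 - s) * wstar j + s * what j := by simp only [hd]; ring
        rw [this]
        have : 0 ≤ 1 - s := by linarith
        positivity)
      (by
        rw [Finset.sum_add_distrib, ← Finset.mul_sum]
        simp only [hd, Finset.sum_sub_distrib]
        rw [hw1, hv1]; ring)
    simp only [hη₀] at hm
    have hm := le_of_mul_le_mul_left hm (by positivity)
    refine hm.trans (le_of_eq (Finset.sum_congr rfl fun t _ => ?_))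
    congr 1
    simp only [hes, hG, Finset.mul_sum, sub_sub, ← Finset.sum_add_distrib]
    congr 1
    exact Finset.sum_congr rfl fun j _ => by ring
  have V2 : ∑ t, eh t * (-Gh t) ≤ 0 := by
    apply aux_var
    intro s hs0 hs1
    have hm := hwhat_min (fun j => what j - s * d j)
      (fun j => by
        have := hw0 j
        have := hv0 j
        have : what j - s * d j = (1 - s) * what j + s * wstar j := by simp only [hd]; ring
        rw [this]
        have : 0 ≤ 1 - s := by linarith
        positivity)
      (by
        rw [Finset.sum_sub_distrib, ← Finset.mul_sum]
        simp only [hd, Finset.sum_sub_distrib]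
        rw [hw1, hv1]; ring)
    simp only [hη₀hat] at hm
    have hm := le_of_mul_le_mul_left hm (by positivity)
    refine hm.trans (le_of_eq (Finset.sum_congr rfl fun t _ => ?_))
    congr 1
    have : ∑ j, μhat j t * (what j - s * d j) = ∑ j, μhat j t * what j - s * Gh t := by
      simp only [hGh, Finset.mul_sum, ← Finset.sum_sub_distrib]
      exact Finset.sum_congr rfl fun j _ => by ring
    rw [this]; simp only [heh]; ring
  have hesG : ∀ t, G t = es t - e t := by
    intro t
    simp only [hG, hes, he, hd, mul_sub, Finset.sum_sub_distrib]; ring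
  have E1 : c * p * ∑ j, d j ^ 2 ≤ ∑ t, G t ^ 2 := by
    refine (aux_eig _ hHerm (c * p) hEig d).trans (le_of_eq ?_)
    rw [← Matrix.mulVec_mulVec, Matrix.dotProduct_mulVec, Matrix.vecMul_transpose]
    simp [dotProduct, Matrix.mulVec, hG, pow_two]
  have habs : ∀ _t : Fin p, ∀ f : Fin K → ℝ, ∀ b : ℝ, (∀ j, |f j| ≤ b) → ∀ w : Fin K → ℝ,
      |∑ j, f j * w j| ≤ b * ∑ j, |w j| := by
    intro _ f b hf w
    refine (Finset.abs_sum_le_sum_abs _ _).trans ?_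
    rw [Finset.mul_sum]
    refine Finset.sum_le_sum fun j _ => ?_
    rw [abs_mul]
    exact mul_le_mul_of_nonneg_right (hf j) (abs_nonneg _)
  have hwabs : ∑ j, |what j| = 1 := by
    rw [← hw1]; exact Finset.sum_congr rfl fun j _ => abs_of_nonneg (hw0 j)
  have hpt : ∀ t, eh t * Gh t - e t * G t ≤
      L * (2 * ((μ0hat t - μ0 t) ^ 2 + ∑ j, (μhat j t - μ j t) ^ 2)
        + 3 * mbar * (|μ0hat t - μ0 t| + ∑ j, |μhat j t - μ j t|)) := by
    intro t
    set a := |μ0hat t - μ0 t| with ha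
    set S := ∑ j, |μhat j t - μ j t| with hS
    set Q := ∑ j, (μhat j t - μ j t) ^ 2 with hQ
    have ha0 : 0 ≤ a := abs_nonneg _
    have hS0 : 0 ≤ S := Finset.sum_nonneg fun j _ => abs_nonneg _
    have hQ0 : 0 ≤ Q := Finset.sum_nonneg fun j _ => sq_nonneg _
    set M := Real.sqrt Q with hM
    have hM0 : 0 ≤ M := Real.sqrt_nonneg _
    have hMM : M ^ 2 = Q := Real.sq_sqrt hQ0
    have hjS : ∀ j, |μhat j t - μ j t| ≤ S := fun j =>
      Finset.single_le_sum (f := fun j => |μhat j t - μ j t|)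
        (fun i _ => abs_nonneg _) (Finset.mem_univ j)
    have hjM : ∀ j, |μhat j t - μ j t| ≤ M := fun j => by
      apply Real.abs_le_sqrt
      exact Finset.single_le_sum (f := fun j => (μhat j t - μ j t) ^ 2)
        (fun i _ => sq_nonneg _) (Finset.mem_univ j)
    have hEd : Gh t - G t = ∑ j, (μhat j t - μ j t) * d j := by
      simp only [hGh, hG, sub_mul, Finset.sum_sub_distrib]
    have hdel : eh t - e t = (μ0hat t - μ0 t) - ∑ j, (μhat j t - μ j t) * what j := by
      simp only [heh, he, sub_mul, Finset.sum_sub_distrib]; ring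
    have b1 : |Gh t - G t| ≤ S * L := by rw [hEd]; exact habs t _ _ hjS d
    have b2 : |Gh t - G t| ≤ M * L := by rw [hEd]; exact habs t _ _ hjM d
    have b3 : |G t| ≤ mbar * L := habs t _ _ (fun j => hμ j t) d
    have b4 : |e t| ≤ 2 * mbar := by
      have h1 := habs t _ _ (fun j => hμ j t) what
      rw [hwabs] at h1
      have := abs_sub (μ0 t) (∑ j, μ j t * what j)
      have := hμ0 t
      simp only [he]; linarith
    have b5 : |eh t - e t| ≤ a + S := by
      have h1 := habs t _ _ hjS what
      rw [hwabs] at h1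
      rw [hdel]
      have := abs_sub (μ0hat t - μ0 t) (∑ j, (μhat j t - μ j t) * what j)
      linarith
    have b6 : |eh t - e t| ≤ a + M := by
      have h1 := habs t _ _ hjM what
      rw [hwabs] at h1
      rw [hdel]
      have := abs_sub (μ0hat t - μ0 t) (∑ j, (μhat j t - μ j t) * what j)
      linarith
    have m : ∀ x y X Y : ℝ, |x| ≤ X → |y| ≤ Y → x * y ≤ X * Y := by
      intro x y X Y hx hy
      refine (le_abs_self _).trans ?_
      rw [abs_mul]
      exact mul_le_mul hx hy (abs_nonneg _) ((abs_nonneg _).trans hx)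
    have c1 := m _ _ _ _ b5 b3
    have c2 := m _ _ _ _ b4 b1
    have c3 := m _ _ _ _ b6 b2
    have c4 : (μ0hat t - μ0 t) ^ 2 = a ^ 2 := (sq_abs _).symm
    rw [c4, ← hMM]
    have c5 : (a + M) * M ≤ 2 * (a ^ 2 + M ^ 2) := by nlinarith [sq_nonneg (a - M)]
    have c6 := mul_le_mul_of_nonneg_right c5 hL0
    have c7 : 0 ≤ mbar * L * a := by positivity
    clear_value a S Q M L
    generalize eh t = x1 at *
    generalize e t = x2 at *
    generalize Gh t = x3 at *
    generalize G t = x4 at *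
    have f1 : x1 * x3 - x2 * x4 = (x1 - x2) * x4 + x2 * (x3 - x4) + (x1 - x2) * (x3 - x4) := by
      ring
    have f2 : L * (2 * (a ^ 2 + M ^ 2) + 3 * mbar * (a + S))
        = 2 * (a ^ 2 + M ^ 2) * L + (a + S) * (mbar * L) + 2 * mbar * (S * L)
          + 2 * (mbar * L * a) := by ring
    have f3 : (a + M) * (M * L) = (a + M) * M * L := by ring
    rw [f1, f2]
    linarith only [c1, c2, c3, c6, c7, f3]
  have hsum : ∑ t, G t ^ 2 ≤ L * (p * (2 * D2sq + 3 * mbar * D1)) := by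
    have h1 : ∑ t, G t ^ 2 ≤ ∑ t, (eh t * Gh t - e t * G t) := by
      have : ∑ t, G t ^ 2 = ∑ t, es t * G t + ∑ t, eh t * (-Gh t)
          + ∑ t, (eh t * Gh t - e t * G t) := by
        rw [← Finset.sum_add_distrib, ← Finset.sum_add_distrib]
        refine Finset.sum_congr rfl fun t _ => ?_
        have := hesG t
        have e' : es t = G t + e t := by linarith
        rw [e']; ring
      linarith
    refine h1.trans ((Finset.sum_le_sum fun t _ => hpt t).trans (le_of_eq ?_))
    rw [← Finset.mul_sum, Finset.sum_add_distrib, ← Finset.mul_sum, ← Finset.mul_sum, hD1, hD2sq]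
    field_simp
  have hD2 : 0 ≤ D2sq := by rw [hD2sq]; positivity
  have hD1' : 0 ≤ D1 := by rw [hD1]; positivity
  have hcs : L ^ 2 ≤ K * ∑ j, d j ^ 2 := by
    have := sq_sum_le_card_mul_sum_sq (s := (Finset.univ : Finset (Fin K))) (f := fun j => |d j|)
    simpa [sq_abs] using this
  have hK0 : (0 : ℝ) < K := by exact_mod_cast hK
  set B := 2 * D2sq + 3 * mbar * D1 with hB
  have hfin : c * ∑ j, d j ^ 2 ≤ L * B := by
    have : p * (c * ∑ j, d j ^ 2) ≤ p * (L * B) := by nlinarith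
    exact le_of_mul_le_mul_left this hp0
  have hLL : L * (c * L) ≤ L * (K * B) := by
    have h1 := mul_le_mul_of_nonneg_left hcs hc.le
    have h2 := mul_le_mul_of_nonneg_left hfin hK0.le
    nlinarith
  have hmD : 0 ≤ mbar * D1 := by positivity
  have hBle : K * B ≤ 4 * K * (D2sq + 3 * mbar * D1) := by
    have h1 : B ≤ 4 * (D2sq + 3 * mbar * D1) := by rw [hB]; nlinarith
    have := mul_le_mul_of_nonneg_left h1 hK0.le
    linarith
  rw [le_div_iff₀ hc]
  rcases hL0.eq_or_lt with h0 | h0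
  · rw [← h0, zero_mul]; positivity
  · have := le_of_mul_le_mul_left hLL h0
    linarith

end
end

section
/- Suppose m̄ > 0, c > 0, |μ_{j,t}| ≤ m̄ for all j ∈ {0,1,…,K} and t ∈ {1,…,p}, |ν_{j,t}| ≤ m̄ for all j ∈ {0,1,…,K} and t ∈ {1,…,q}, and λ_min(ΓᵀΓ) ≥ c·p. Let ŵ ∈ Δ_{K−1} be a minimizer of η̂₀ over Δ_{K−1} and w* ∈ Δ_{K−1} a minimizer of η₀ over Δ_{K−1}. Then |η₁(ŵ) − η₁(w*)| ≤ 32·m̄²·K·(D̂_{0,2}² + 3·m̄·D̂_{0,1}) / c. -/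
open Matrix

noncomputable section

theorem ssme_holder {K : ℕ} (x y : Fin K → ℝ) (M : ℝ) (hx : ∀ j, |x j| ≤ M) :
    |∑ j, x j * y j| ≤ M * ∑ j, |y j| := by
  calc |∑ j, x j * y j| ≤ ∑ j, |x j * y j| := Finset.abs_sum_le_sum_abs _ _
    _ ≤ ∑ j, M * |y j| := by
        apply Finset.sum_le_sum
        intro j _
        rw [abs_mul]
        exact mul_le_mul_of_nonneg_right (hx j) (abs_nonneg _)
    _ = M * ∑ j, |y j| := by rw [Finset.mul_sum]

theorem ssme_simplex_bound {K : ℕ} (x w : Fin K → ℝ) (M : ℝ) (hx : ∀ j, |x j| ≤ M)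
    (hw : (∀ j, 0 ≤ w j) ∧ ∑ j, w j = 1) : |∑ j, x j * w j| ≤ M := by
  have h := ssme_holder x w M hx
  have h2 : ∑ j, |w j| = 1 := by
    rw [← hw.2]
    exact Finset.sum_congr rfl fun j _ => abs_of_nonneg (hw.1 j)
  rwa [h2, mul_one] at h

theorem ssme_foc {K p : ℕ} (hp : 1 ≤ p) (a : Fin p → ℝ) (b : Fin K → Fin p → ℝ)
    (w v : Fin K → ℝ)
    (hw : (∀ j, 0 ≤ w j) ∧ ∑ j, w j = 1) (hv : (∀ j, 0 ≤ v j) ∧ ∑ j, v j = 1)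
    (hmin : ∀ u : Fin K → ℝ, (∀ j, 0 ≤ u j) → (∑ j, u j = 1) →
      (1 / (p : ℝ)) * ∑ t, (a t - ∑ j, b j t * w j) ^ 2 ≤
      (1 / (p : ℝ)) * ∑ t, (a t - ∑ j, b j t * u j) ^ 2) :
    ∑ t, (a t - ∑ j, b j t * w j) * (∑ j, b j t * (v j - w j)) ≤ 0 := by
  have hp' : (0 : ℝ) < 1 / (p : ℝ) := by
    have : (0 : ℝ) < p := by exact_mod_cast hp
    positivity
  set A := ∑ t, (a t - ∑ j, b j t * w j) * (∑ j, b j t * (v j - w j)) with hA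
  set G := ∑ t, (∑ j, b j t * (v j - w j)) ^ 2 with hG
  have hG0 : 0 ≤ G := Finset.sum_nonneg fun t _ => sq_nonneg _
  have key : ∀ s : ℝ, 0 ≤ s → s ≤ 1 → 0 ≤ -2 * s * A + s ^ 2 * G := by
    intro s hs0 hs1
    have hpos : ∀ j, 0 ≤ w j + s * (v j - w j) := by
      intro j
      have h1 := mul_nonneg hs0 (hv.1 j)
      have h2 := mul_nonneg (sub_nonneg.2 hs1) (hw.1 j)
      nlinarith
    have h := hmin (fun j => w j + s * (v j - w j))
      hpos
      (by rw [Finset.sum_add_distrib, ← Finset.mul_sum, Finset.sum_sub_distrib, hw.2, hv.2]; ring)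
    have h := le_of_mul_le_mul_left h hp'
    have e : ∑ t, (a t - ∑ j, b j t * (w j + s * (v j - w j))) ^ 2
        = ∑ t, (a t - ∑ j, b j t * w j) ^ 2 + (-2 * s * A + s ^ 2 * G) := by
      rw [hA, hG, Finset.mul_sum, Finset.mul_sum, ← Finset.sum_add_distrib,
        ← Finset.sum_add_distrib]
      apply Finset.sum_congr rfl
      intro t _
      have : ∑ j, b j t * (w j + s * (v j - w j))
          = ∑ j, b j t * w j + s * ∑ j, b j t * (v j - w j) := by
        rw [Finset.mul_sum, ← Finset.sum_add_distrib]
        exact Finset.sum_congr rfl fun j _ => by ring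
      rw [this]
      ring
    linarith [e ▸ h]
  by_contra hcon
  push Not at hcon
  have hAG : 0 < A + G := by linarith
  have h := key (A / (A + G)) (by positivity) (by rw [div_le_one hAG]; linarith)
  have e : -2 * (A / (A + G)) * A + (A / (A + G)) ^ 2 * G
      = A ^ 2 * (-2 * A - G) / (A + G) ^ 2 := by
    field_simp
    ring
  rw [e] at h
  have : A ^ 2 * (-2 * A - G) / (A + G) ^ 2 < 0 := by
    apply div_neg_of_neg_of_pos
    · exact mul_neg_of_pos_of_neg (by positivity) (by linarith)
    · positivity
  linarith

theorem ssme_rayleigh {K : ℕ} (A : Matrix (Fin K) (Fin K) ℝ) (hA : A.IsHermitian) (l : ℝ)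
    (hl : ∀ i, l ≤ hA.eigenvalues i) (x : Fin K → ℝ) :
    l * (x ⬝ᵥ x) ≤ x ⬝ᵥ (A *ᵥ x) := by
  have hT : Aᵀ = A := by simpa [Matrix.IsHermitian, conjTranspose_eq_transpose_of_trivial] using hA
  have h1 := hA.eigenvectorBasis.sum_inner_mul_inner (WithLp.toLp 2 x) (WithLp.toLp 2 x)
  have h2 := hA.eigenvectorBasis.sum_inner_mul_inner (WithLp.toLp 2 x) (WithLp.toLp 2 (A *ᵥ x))
  simp only [EuclideanSpace.inner_eq_star_dotProduct, star_trivial] at h1 h2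
  rw [dotProduct_comm x (A *ᵥ x), ← h2, ← h1, Finset.mul_sum]
  apply Finset.sum_le_sum
  intro i _
  have e : (A *ᵥ x) ⬝ᵥ (hA.eigenvectorBasis i).ofLp
      = hA.eigenvalues i * (x ⬝ᵥ (hA.eigenvectorBasis i).ofLp) := by
    rw [dotProduct_comm, dotProduct_mulVec, ← mulVec_transpose, hT, hA.mulVec_eigenvectorBasis,
      smul_dotProduct, smul_eq_mul, dotProduct_comm]
  rw [e, dotProduct_comm (hA.eigenvectorBasis i).ofLp x]
  nlinarith [hl i, sq_nonneg (x ⬝ᵥ (hA.eigenvectorBasis i).ofLp),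
    mul_le_mul_of_nonneg_right (hl i) (mul_self_nonneg (x ⬝ᵥ (hA.eigenvectorBasis i).ofLp))]

theorem ssme_pointwise {K : ℕ} (hK : 1 ≤ K) (m0 e0 m : ℝ) (mu ep w d : Fin K → ℝ)
    (hm0 : |m0| ≤ m) (hmu : ∀ j, |mu j| ≤ m) (hw : (∀ j, 0 ≤ w j) ∧ ∑ j, w j = 1) :
    (e0 - ∑ j, ep j * w j) * (∑ j, mu j * d j)
      + (m0 - ∑ j, mu j * w j) * (∑ j, ep j * d j)
      + (e0 - ∑ j, ep j * w j) * (∑ j, ep j * d j)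
    ≤ (∑ j, |d j|) * (3 * m * (|e0| + ∑ j, |ep j|)
      + 3 / 2 * (e0 ^ 2 + ∑ j, ep j ^ 2)) := by
  have : Nonempty (Fin K) := ⟨⟨0, hK⟩⟩
  obtain ⟨j0, -, hj0⟩ := Finset.exists_max_image Finset.univ (fun j => |ep j|)
    Finset.univ_nonempty
  have hM : ∀ j, |ep j| ≤ |ep j0| := fun j => hj0 j (Finset.mem_univ j)
  have hS1 : |ep j0| ≤ ∑ j, |ep j| :=
    Finset.single_le_sum (f := fun j => |ep j|) (fun j _ => abs_nonneg _) (Finset.mem_univ j0)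
  have hS2 : |ep j0| ^ 2 ≤ ∑ j, ep j ^ 2 := by
    rw [sq_abs]
    exact Finset.single_le_sum (f := fun j => ep j ^ 2) (fun j _ => sq_nonneg _)
      (Finset.mem_univ j0)
  set M := |ep j0| with hMdef
  have hM0 : 0 ≤ M := abs_nonneg _
  have hm : 0 ≤ m := (abs_nonneg _).trans hm0
  have b1 := ssme_holder mu d m hmu
  have b2 := ssme_holder ep d M hM
  have b3 := ssme_simplex_bound ep w M hM hw
  have b4 := ssme_simplex_bound mu w m hmu hw
  have hL : 0 ≤ ∑ j, |d j| := Finset.sum_nonneg fun j _ => abs_nonneg _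
  set L := ∑ j, |d j|
  have c1 : |e0 - ∑ j, ep j * w j| ≤ |e0| + M := (abs_sub _ _).trans (by linarith)
  have c2 : |m0 - ∑ j, mu j * w j| ≤ 2 * m := (abs_sub _ _).trans (by linarith)
  have he0 : 0 ≤ |e0| := abs_nonneg _
  have p1 := (le_abs_self _).trans ((abs_mul (e0 - ∑ j, ep j * w j) (∑ j, mu j * d j)).le.trans
    (mul_le_mul c1 b1 (abs_nonneg _) (by positivity)))
  have p2 := (le_abs_self _).trans ((abs_mul (m0 - ∑ j, mu j * w j) (∑ j, ep j * d j)).le.trans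
    (mul_le_mul c2 b2 (abs_nonneg _) (by positivity)))
  have p3 := (le_abs_self _).trans ((abs_mul (e0 - ∑ j, ep j * w j) (∑ j, ep j * d j)).le.trans
    (mul_le_mul c1 b2 (abs_nonneg _) (by positivity)))
  have q : (|e0| + M) * m + 2 * m * M + (|e0| + M) * M ≤ 3 * m * (|e0| + ∑ j, |ep j|)
      + 3 / 2 * (e0 ^ 2 + ∑ j, ep j ^ 2) := by
    have := mul_le_mul_of_nonneg_left hS1 hm
    have := mul_nonneg hm he0
    nlinarith [sq_nonneg (|e0| - M), sq_abs e0, sq_nonneg e0]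
  nlinarith [mul_le_mul_of_nonneg_left q hL]

/-- Under boundedness of the pre- and post-treatment group means and
the eigenvalue condition `λ_min(ΓᵀΓ) ≥ c·p`, the post-treatment SSME evaluated at the
SCD weight estimate `ŵ` differs from its value at the population SCD weight `w*` by
at most `32 m̄² K (D̂_{0,2}² + 3 m̄ D̂_{0,1})/c`. -/
theorem post_treatment_ssme_bound
    (K p q : ℕ) (hK : 1 ≤ K) (hp : 1 ≤ p) (hq : 1 ≤ q)
    (μ0 : Fin p → ℝ) (μ : Fin K → Fin p → ℝ)
    (ν0 : Fin q → ℝ) (ν : Fin K → Fin q → ℝ)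
    (μ0hat : Fin p → ℝ) (μhat : Fin K → Fin p → ℝ)
    (η₀ η₀hat η₁ D1 D2sq : _)
    (hη₀ : η₀ = fun w : Fin K → ℝ =>
      (1 / (p : ℝ)) * ∑ t : Fin p, (μ0 t - ∑ j : Fin K, μ j t * w j) ^ 2)
    (hη₀hat : η₀hat = fun w : Fin K → ℝ =>
      (1 / (p : ℝ)) * ∑ t : Fin p, (μ0hat t - ∑ j : Fin K, μhat j t * w j) ^ 2)
    (hη₁ : η₁ = fun w : Fin K → ℝ =>
      (1 / (q : ℝ)) * ∑ t : Fin q, (ν0 t - ∑ j : Fin K, ν j t * w j) ^ 2)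
    (hD1 : D1 = (1 / (p : ℝ)) * ∑ t : Fin p,
      (|μ0hat t - μ0 t| + ∑ j : Fin K, |μhat j t - μ j t|))
    (hD2sq : D2sq = (1 / (p : ℝ)) * ∑ t : Fin p,
      ((μ0hat t - μ0 t) ^ 2 + ∑ j : Fin K, (μhat j t - μ j t) ^ 2))
    (mbar c : ℝ) (hmbar : 0 < mbar) (hc : 0 < c)
    (hμ0 : ∀ t, |μ0 t| ≤ mbar) (hμ : ∀ j t, |μ j t| ≤ mbar)
    (hν0 : ∀ t, |ν0 t| ≤ mbar) (hν : ∀ j t, |ν j t| ≤ mbar)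
    (hHerm : ((Matrix.of fun (t : Fin p) (j : Fin K) => μ j t)ᵀ
        * (Matrix.of fun (t : Fin p) (j : Fin K) => μ j t)).IsHermitian)
    (hEig : ∀ i : Fin K, c * (p : ℝ) ≤ hHerm.eigenvalues i)
    (what : Fin K → ℝ)
    (hwhat_mem : (∀ j, 0 ≤ what j) ∧ ∑ j : Fin K, what j = 1)
    (hwhat_min : ∀ w : Fin K → ℝ, (∀ j, 0 ≤ w j) → (∑ j : Fin K, w j = 1) →
      η₀hat what ≤ η₀hat w)
    (wstar : Fin K → ℝ)
    (hwstar_mem : (∀ j, 0 ≤ wstar j) ∧ ∑ j : Fin K, wstar j = 1)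
    (hwstar_min : ∀ w : Fin K → ℝ, (∀ j, 0 ≤ w j) → (∑ j : Fin K, w j = 1) →
      η₀ wstar ≤ η₀ w) :
    |η₁ what - η₁ wstar| ≤ 32 * mbar ^ 2 * (K : ℝ) * (D2sq + 3 * mbar * D1) / c := by
  have hp0 : (0 : ℝ) < p := by exact_mod_cast hp
  have hq0 : (0 : ℝ) < q := by exact_mod_cast hq
  have hK0 : (0 : ℝ) < K := by exact_mod_cast hK
  subst hη₀ hη₀hat hη₁
  have f1 := ssme_foc hp μ0hat μhat what wstar hwhat_mem hwstar_mem hwhat_min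
  have f2 := ssme_foc hp μ0 μ wstar what hwstar_mem hwhat_mem hwstar_min
  set d : Fin K → ℝ := fun j => what j - wstar j with hd
  set L := ∑ j, |d j| with hLdef
  have hL : 0 ≤ L := Finset.sum_nonneg fun j _ => abs_nonneg _
  -- quadratic growth
  have hray := ssme_rayleigh _ hHerm _ hEig d
  have hquad : d ⬝ᵥ (((Matrix.of fun (t : Fin p) (j : Fin K) => μ j t)ᵀ
        * (Matrix.of fun (t : Fin p) (j : Fin K) => μ j t)) *ᵥ d)
      = ∑ t, (∑ j, μ j t * d j) ^ 2 := by
    rw [← mulVec_mulVec, dotProduct_mulVec, ← mulVec_transpose, transpose_transpose]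
    simp only [dotProduct, mulVec, of_apply, sq]
  rw [hquad] at hray
  have hCS : L ^ 2 ≤ K * (d ⬝ᵥ d) := by
    have h := sq_sum_le_card_mul_sum_sq (s := (Finset.univ : Finset (Fin K)))
      (f := fun j => |d j|)
    simpa [dotProduct, sq_abs, ← sq] using h
  have hB : ∑ t, (∑ j, μ j t * d j) ^ 2 ≤ L * (p * (3 * mbar * D1 + 3 / 2 * D2sq)) := by
    have e : p * (3 * mbar * D1 + 3 / 2 * D2sq)
        = ∑ t : Fin p, (3 * mbar * (|μ0hat t - μ0 t| + ∑ j : Fin K, |μhat j t - μ j t|)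
          + 3 / 2 * ((μ0hat t - μ0 t) ^ 2 + ∑ j : Fin K, (μhat j t - μ j t) ^ 2)) := by
      rw [Finset.sum_add_distrib, ← Finset.mul_sum, ← Finset.mul_sum, hD1, hD2sq]
      field_simp
    have hs := Finset.sum_le_sum fun (t : Fin p) (_ : t ∈ Finset.univ) =>
      ssme_pointwise hK (μ0 t) (μ0hat t - μ0 t) mbar (fun j => μ j t)
        (fun j => μhat j t - μ j t) what d (hμ0 t) (fun j => hμ j t) hwhat_mem
    rw [← Finset.mul_sum, ← e] at hs
    refine le_trans ?_ hs
    have e2 : ∑ t, (μ0hat t - ∑ j, μhat j t * what j) * ∑ j, μhat j t * (wstar j - what j)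
        + ∑ t, (μ0 t - ∑ j, μ j t * wstar j) * ∑ j, μ j t * (what j - wstar j)
        = ∑ t, ((∑ j, μ j t * d j) ^ 2 -
          ((μ0hat t - μ0 t - ∑ j, (μhat j t - μ j t) * what j) * (∑ j, μ j t * d j)
          + (μ0 t - ∑ j, μ j t * what j) * (∑ j, (μhat j t - μ j t) * d j)
          + (μ0hat t - μ0 t - ∑ j, (μhat j t - μ j t) * what j)
            * (∑ j, (μhat j t - μ j t) * d j))) := by
      rw [← Finset.sum_add_distrib]
      apply Finset.sum_congr rfl
      intro t _
      simp only [hd, mul_sub, sub_mul, Finset.sum_sub_distrib]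
      ring
    rw [Finset.sum_sub_distrib] at e2
    linarith
  have hD1n : 0 ≤ D1 := by rw [hD1]; positivity
  have hD2n : 0 ≤ D2sq := by rw [hD2sq]; positivity
  set B := D2sq + 3 * mbar * D1 with hBdef
  have hBn : 0 ≤ B := by positivity
  have hLB : c * L ≤ 3 / 2 * K * B := by
    rcases hL.eq_or_lt with h0 | hpos
    · rw [← h0]; simp only [mul_zero]; positivity
    · have h1 : c * (d ⬝ᵥ d) ≤ L * (3 / 2 * B) := by
        have : (p : ℝ) * (c * (d ⬝ᵥ d)) ≤ p * (L * (3 / 2 * B)) := by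
          have : 0 ≤ L * (p * (3 / 2 * (mbar * D1))) := by positivity
          rw [hBdef]
          nlinarith
        exact le_of_mul_le_mul_left this hp0
      have h2 : L * (c * L) ≤ L * (3 / 2 * K * B) := by
        have h3 := mul_le_mul_of_nonneg_left hCS hc.le
        have h4 := mul_le_mul_of_nonneg_left h1 hK0.le
        nlinarith
      exact le_of_mul_le_mul_left h2 hpos
  -- post-treatment Lipschitz bound
  have hpost : |(1 / (q : ℝ)) * ∑ t : Fin q, (ν0 t - ∑ j : Fin K, ν j t * what j) ^ 2
      - (1 / (q : ℝ)) * ∑ t : Fin q, (ν0 t - ∑ j : Fin K, ν j t * wstar j) ^ 2|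
      ≤ 4 * mbar ^ 2 * L := by
    rw [← mul_sub, ← Finset.sum_sub_distrib, abs_mul, abs_of_pos (by positivity : 0 < 1 / (q : ℝ))]
    have : |∑ t : Fin q, ((ν0 t - ∑ j : Fin K, ν j t * what j) ^ 2
        - (ν0 t - ∑ j : Fin K, ν j t * wstar j) ^ 2)| ≤ ∑ t : Fin q, 4 * mbar ^ 2 * L := by
      refine (Finset.abs_sum_le_sum_abs _ _).trans (Finset.sum_le_sum fun t _ => ?_)
      have g1 := ssme_simplex_bound (fun j => ν j t) what mbar (fun j => hν j t) hwhat_mem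
      have g2 := ssme_simplex_bound (fun j => ν j t) wstar mbar (fun j => hν j t) hwstar_mem
      have g3 := ssme_holder (fun j => ν j t) d mbar (fun j => hν j t)
      have e : (ν0 t - ∑ j : Fin K, ν j t * what j) ^ 2
          - (ν0 t - ∑ j : Fin K, ν j t * wstar j) ^ 2
          = (∑ j, ν j t * what j + ∑ j, ν j t * wstar j - 2 * ν0 t) * ∑ j, ν j t * d j := by
        simp only [hd, mul_sub, Finset.sum_sub_distrib]
        ring
      have g4 : |∑ j, ν j t * what j + ∑ j, ν j t * wstar j - 2 * ν0 t| ≤ 4 * mbar := by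
        have := hν0 t
        rw [abs_le] at *
        constructor <;> linarith
      rw [e, abs_mul]
      calc _ ≤ 4 * mbar * (mbar * L) := mul_le_mul g4 g3 (abs_nonneg _) (by positivity)
        _ = _ := by ring
    rw [Finset.sum_const, Finset.card_univ, Fintype.card_fin, nsmul_eq_mul] at this
    calc _ ≤ 1 / (q : ℝ) * (q * (4 * mbar ^ 2 * L)) :=
          mul_le_mul_of_nonneg_left this (by positivity)
      _ = _ := by field_simp
  refine hpost.trans ?_
  rw [le_div_iff₀ hc]
  have h5 := mul_le_mul_of_nonneg_left hLB (by positivity : 0 ≤ 4 * mbar ^ 2)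
  have h6 : 0 ≤ mbar ^ 2 * K * B := by positivity
  nlinarith

end
end

section
/- Suppose m̄ > 0 and |μ_{j,t}| ≤ 2·m̄ for all j ∈ {0,1,…,K} and all t ∈ {1,…,p}. Then for every w ∈ Δ_{K−1}, |η̂₀(w) − η₀(w)| ≤ 8·m̄·D̂_{0,1} + 2·D̂_{0,2}². -/
noncomputable section

/-- Weighted averages over the simplex are bounded by a common bound. -/
theorem aux_avg_le {K : ℕ} (w x : Fin K → ℝ) (hw : ∀ j, 0 ≤ w j) (hs : ∑ j, w j = 1)
    (c : ℝ) (hx : ∀ j, |x j| ≤ c) : |∑ j, x j * w j| ≤ c := by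
  calc |∑ j, x j * w j| ≤ ∑ j, |x j * w j| := Finset.abs_sum_le_sum_abs _ _
    _ ≤ ∑ j, c * w j := by
        refine Finset.sum_le_sum fun j _ => ?_
        rw [abs_mul, abs_of_nonneg (hw j)]
        exact mul_le_mul_of_nonneg_right (hx j) (hw j)
    _ = c := by rw [← Finset.mul_sum, hs, mul_one]

/-- The bound for a single period. -/
theorem aux_period {K : ℕ} (w : Fin K → ℝ) (hw : ∀ j, 0 ≤ w j) (hs : ∑ j, w j = 1)
    (a a' m : ℝ) (x x' : Fin K → ℝ) (ha : |a| ≤ 2 * m) (hx : ∀ j, |x j| ≤ 2 * m) :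
    |(a' - ∑ j, x' j * w j) ^ 2 - (a - ∑ j, x j * w j) ^ 2| ≤
      8 * m * (|a' - a| + ∑ j, |x' j - x j|) + 2 * ((a' - a) ^ 2 + ∑ j, (x' j - x j) ^ 2) := by
  have hw1 : ∀ j, w j ≤ 1 := fun j => by
    rw [← hs]; exact Finset.single_le_sum (fun i _ => hw i) (Finset.mem_univ j)
  have h1 := aux_avg_le w x hw hs _ hx
  have h2 : |∑ j, (x' j - x j) * w j| ≤ ∑ j, |x' j - x j| :=
    aux_avg_le w _ hw hs _ fun j =>
      Finset.single_le_sum (f := fun i => |x' i - x i|) (fun i _ => abs_nonneg _)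
        (Finset.mem_univ j)
  have h3 : (∑ j, (x' j - x j) * w j) ^ 2 ≤ ∑ j, (x' j - x j) ^ 2 := by
    have := Real.pow_arith_mean_le_arith_mean_pow_of_even Finset.univ w
      (fun j => x' j - x j) (fun j _ => hw j) hs (n := 2) even_two
    calc (∑ j, (x' j - x j) * w j) ^ 2 = (∑ j, w j * (x' j - x j)) ^ 2 := by
          simp only [mul_comm]
      _ ≤ ∑ j, w j * (x' j - x j) ^ 2 := this
      _ ≤ _ := Finset.sum_le_sum fun j _ => mul_le_of_le_one_left (sq_nonneg _) (hw1 j)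
  have h4 : ∑ j, x' j * w j = ∑ j, x j * w j + ∑ j, (x' j - x j) * w j := by
    rw [← Finset.sum_add_distrib]
    exact Finset.sum_congr rfl fun j _ => by ring
  rw [h4]
  generalize ∑ j, x j * w j = b at *
  generalize ∑ j, (x' j - x j) * w j = d at *
  generalize ∑ j, |x' j - x j| = S at *
  generalize ∑ j, (x' j - x j) ^ 2 = Q at *
  have e1 : (a' - (b + d)) ^ 2 - (a - b) ^ 2
      = 2 * ((a - b) * ((a' - a) - d)) + ((a' - a) - d) ^ 2 := by ring
  have e2 : |a - b| ≤ 4 * m := (abs_sub a b).trans (by linarith)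
  have e3 : |(a' - a) - d| ≤ |a' - a| + S := (abs_sub _ _).trans (by linarith)
  have e4 : |(a - b) * ((a' - a) - d)| ≤ 4 * m * (|a' - a| + S) := by
    rw [abs_mul]
    exact mul_le_mul e2 e3 (abs_nonneg _) ((abs_nonneg _).trans e2)
  have e5 : ((a' - a) - d) ^ 2 ≤ 2 * ((a' - a) ^ 2 + Q) := by
    nlinarith [sq_nonneg ((a' - a) + d)]
  rw [e1]
  have e6 := abs_le.1 e4
  have e7 := sq_nonneg ((a' - a) - d)
  rw [abs_le]
  constructor <;> linarith [e6.1, e6.2]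

/-- If the pre-treatment group means are bounded by `2 m̄`, then the
sample pre-treatment SSME is uniformly close to the population one:
`|η̂₀(w) − η₀(w)| ≤ 8 m̄ D̂_{0,1} + 2 D̂_{0,2}²` for every `w` in the simplex. -/
theorem ssme_uniform_deviation_bound
    (K p : ℕ) (hK : 1 ≤ K) (hp : 1 ≤ p)
    (μ0 : Fin p → ℝ) (μ : Fin K → Fin p → ℝ)
    (μ0hat : Fin p → ℝ) (μhat : Fin K → Fin p → ℝ)
    (η₀ η₀hat D1 D2sq : _)
    (hη₀ : η₀ = fun w : Fin K → ℝ =>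
      (1 / (p : ℝ)) * ∑ t : Fin p, (μ0 t - ∑ j : Fin K, μ j t * w j) ^ 2)
    (hη₀hat : η₀hat = fun w : Fin K → ℝ =>
      (1 / (p : ℝ)) * ∑ t : Fin p, (μ0hat t - ∑ j : Fin K, μhat j t * w j) ^ 2)
    (hD1 : D1 = (1 / (p : ℝ)) * ∑ t : Fin p,
      (|μ0hat t - μ0 t| + ∑ j : Fin K, |μhat j t - μ j t|))
    (hD2sq : D2sq = (1 / (p : ℝ)) * ∑ t : Fin p,
      ((μ0hat t - μ0 t) ^ 2 + ∑ j : Fin K, (μhat j t - μ j t) ^ 2))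
    (mbar : ℝ) (hmbar : 0 < mbar)
    (hμ0 : ∀ t, |μ0 t| ≤ 2 * mbar) (hμ : ∀ j t, |μ j t| ≤ 2 * mbar) :
    ∀ w : Fin K → ℝ, (∀ j, 0 ≤ w j) → (∑ j : Fin K, w j = 1) →
      |η₀hat w - η₀ w| ≤ 8 * mbar * D1 + 2 * D2sq := by
  intro w hw hs
  subst hη₀ hη₀hat hD1 hD2sq
  have hp0 : (0 : ℝ) ≤ 1 / (p : ℝ) := by positivity
  simp only
  rw [← mul_sub, ← Finset.sum_sub_distrib, abs_mul, abs_of_nonneg hp0]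
  have key := (Finset.abs_sum_le_sum_abs (fun t => (μ0hat t - ∑ j, μhat j t * w j) ^ 2
      - (μ0 t - ∑ j, μ j t * w j) ^ 2) Finset.univ).trans
    (Finset.sum_le_sum fun t _ => aux_period w hw hs (μ0 t) (μ0hat t) mbar
      (fun j => μ j t) (fun j => μhat j t) (hμ0 t) (fun j => hμ j t))
  rw [Finset.sum_add_distrib, ← Finset.mul_sum, ← Finset.mul_sum] at key
  refine (mul_le_mul_of_nonneg_left key hp0).trans (le_of_eq ?_)
  ring

end
end

section
/- Suppose c > 0 and λ_min(ΓᵀΓ) ≥ c·p. Let w^DID ∈ Δ_{K−1} satisfy e_t(w^DID) = 0 for every t ∈ {1,…,p} (the pre-treatment parallel trend condition), and let w* ∈ Δ_{K−1} be a minimizer of η₀ over Δ_{K−1} (the population SCD weight). Then w* = w^DID; that is, the DID and SCD designs select identical matching weights. -/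
open Matrix

noncomputable section

/-- If `λ_min(ΓᵀΓ) ≥ c·p` with `c > 0`, `w^DID` lies in the simplex
and satisfies the pre-treatment parallel trend condition `e_t(w^DID) = 0` for all
pre-treatment periods `t`, and `w*` minimizes the pre-treatment SSME `η₀` over the
simplex, then `w* = w^DID`: the DID and SCD designs select identical weights. -/
theorem did_scd_equivalence
    (K p : ℕ) (hK : 1 ≤ K) (hp : 1 ≤ p)
    (μ0 : Fin p → ℝ) (μ : Fin K → Fin p → ℝ)
    (η₀ : (Fin K → ℝ) → ℝ)
    (hη₀ : η₀ = fun w : Fin K → ℝ =>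
      (1 / (p : ℝ)) * ∑ t : Fin p, (μ0 t - ∑ j : Fin K, μ j t * w j) ^ 2)
    (c : ℝ) (hc : 0 < c)
    (hHerm : ((Matrix.of fun (t : Fin p) (j : Fin K) => μ j t)ᵀ
        * (Matrix.of fun (t : Fin p) (j : Fin K) => μ j t)).IsHermitian)
    (hEig : ∀ i : Fin K, c * (p : ℝ) ≤ hHerm.eigenvalues i)
    (wDID : Fin K → ℝ)
    (hwDID_mem : (∀ j, 0 ≤ wDID j) ∧ ∑ j : Fin K, wDID j = 1)
    (hwDID_pta : ∀ t : Fin p, μ0 t - ∑ j : Fin K, μ j t * wDID j = 0)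
    (wstar : Fin K → ℝ)
    (hwstar_mem : (∀ j, 0 ≤ wstar j) ∧ ∑ j : Fin K, wstar j = 1)
    (hwstar_min : ∀ w : Fin K → ℝ, (∀ j, 0 ≤ w j) → (∑ j : Fin K, w j = 1) →
      η₀ wstar ≤ η₀ w) :
    wstar = wDID := by
  have hp' : (0 : ℝ) < p := by exact_mod_cast hp
  have h1 := hwstar_min wDID hwDID_mem.1 hwDID_mem.2
  rw [hη₀] at h1
  simp only [hwDID_pta] at h1
  have h2 : ∑ t : Fin p, (μ0 t - ∑ j : Fin K, μ j t * wstar j) ^ 2 ≤ 0 := by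
    have h3 : (1 / (p : ℝ)) * ∑ t : Fin p, (μ0 t - ∑ j : Fin K, μ j t * wstar j) ^ 2 ≤ 0 := by
      simpa using h1
    by_contra hcon
    have : 0 < (1 / (p : ℝ)) * ∑ t : Fin p, (μ0 t - ∑ j : Fin K, μ j t * wstar j) ^ 2 :=
      mul_pos (by positivity) (not_le.mp hcon)
    linarith
  have h4 : ∀ t : Fin p, μ0 t - ∑ j : Fin K, μ j t * wstar j = 0 := by
    intro t
    have h5 := Finset.single_le_sum
      (f := fun t : Fin p => (μ0 t - ∑ j : Fin K, μ j t * wstar j) ^ 2)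
      (fun i _ => sq_nonneg _) (Finset.mem_univ t)
    exact pow_eq_zero_iff (two_ne_zero) |>.mp (le_antisymm (h5.trans h2) (sq_nonneg _))
  have hdet : ((Matrix.of fun (t : Fin p) (j : Fin K) => μ j t)ᵀ
        * (Matrix.of fun (t : Fin p) (j : Fin K) => μ j t)).det ≠ 0 := by
    rw [hHerm.det_eq_prod_eigenvalues]
    refine Finset.prod_ne_zero_iff.mpr fun i _ => ?_
    have : 0 < hHerm.eigenvalues i := lt_of_lt_of_le (mul_pos hc hp') (hEig i)
    exact this.ne'
  have hz : wstar - wDID = 0 := by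
    refine Matrix.eq_zero_of_mulVec_eq_zero hdet ?_
    rw [← Matrix.mulVec_mulVec]
    have : (Matrix.of fun (t : Fin p) (j : Fin K) => μ j t) *ᵥ (wstar - wDID) = 0 := by
      ext t
      rw [Matrix.mulVec_sub]
      simp only [Matrix.mulVec, dotProduct, Matrix.of_apply, Pi.sub_apply, Pi.zero_apply]
      linarith [h4 t, hwDID_pta t]
    rw [this, Matrix.mulVec_zero]
  exact sub_eq_zero.mp hz

end
end
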